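/- Assume n ≥ 2, and let u, v ∈ [n]. Then [t_u, t_{n−1}] · [t_v, t_{n−1}] = 0 in k[S_n]. -/

import Mathlib

/-- The simple transposition `s_i ∈ S_n` (1-based indexing), swapping `i` and `i+1`,
defined as the identity for `i` outside `{1, …, n-1}`. -/
def simpleTransposition (n i : ℕ) : Equiv.Perm (Fin n) :=
  if h : 1 ≤ i ∧ i < n then
    Equiv.swap ⟨i - 1, by omega⟩ ⟨i, h.2⟩
  else 1

/-- The cycle `(v ⟹ w) = s_v s_{v+1} ⋯ s_{w-1} ∈ S_n`, sending
`v ↦ v+1 ↦ ⋯ ↦ w ↦ v` (and equal to the identity when `v = w`). -/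
def cyc (n v w : ℕ) : Equiv.Perm (Fin n) :=
  ((List.range' v (w - v)).map (simpleTransposition n)).prod

/-- The somewhere-to-below shuffle `t_ℓ = Σ_{w=ℓ}^{n} (ℓ ⟹ w)` in the group
algebra `R[S_n]`. -/
noncomputable def t (R : Type*) [CommRing R] (n ℓ : ℕ) :
    MonoidAlgebra R (Equiv.Perm (Fin n)) :=
  ∑ w ∈ Finset.Icc ℓ n, MonoidAlgebra.of R (Equiv.Perm (Fin n)) (cyc n ℓ w)

theorem simpleTransposition_mul_self (n i : ℕ) :
    simpleTransposition n i * simpleTransposition n i = 1 := by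
  unfold simpleTransposition
  split_ifs <;> simp

/-- Simple transpositions at distance at least two commute. -/
theorem simpleTransposition_commute (n : ℕ) {i j : ℕ} (h : i + 1 < j) :
    Commute (simpleTransposition n i) (simpleTransposition n j) := by
  unfold simpleTransposition
  split_ifs with hi hj
  · refine (Equiv.Perm.disjoint_swap_swap ?_).commute
    simp only [List.nodup_cons, List.mem_cons, Fin.mk.injEq, List.not_mem_nil, or_false,
      List.nodup_nil, not_false_eq_true, and_true]
    omega
  all_goals simp

theorem cyc_self (n v : ℕ) : cyc n v v = 1 := by simp [cyc]

theorem cyc_succ (n : ℕ) {v w : ℕ} (h : v ≤ w) :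
    cyc n v (w + 1) = cyc n v w * simpleTransposition n w := by
  have hw : w + 1 - v = (w - v) + 1 := by omega
  simp [cyc, hw, List.range'_concat, Nat.add_sub_cancel' h]

theorem cyc_commute (n v : ℕ) {w j : ℕ} (h : w < j) :
    Commute (cyc n v w) (simpleTransposition n j) := by
  refine Commute.list_prod_left _ _ fun x hx => ?_
  obtain ⟨i, hi, rfl⟩ := List.mem_map.mp hx
  have := List.mem_range'_1.mp hi
  exact simpleTransposition_commute n (by omega)

theorem t_self (R : Type*) [CommRing R] (n : ℕ) : t R n n = 1 := by
  simp [t, cyc_self, MonoidAlgebra.one_def]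

theorem t_penultimate (R : Type*) [CommRing R] (m : ℕ) :
    t R (m + 2) (m + 1) = 1 + MonoidAlgebra.of R _ (simpleTransposition (m + 2) (m + 1)) := by
  rw [t, Finset.sum_Icc_succ_top (by omega), Finset.Icc_self, Finset.sum_singleton,
    cyc_succ _ le_rfl, cyc_self, one_mul, map_one]

/-- The commutator of a somewhere-to-below shuffle with the penultimate one factors through
`1 - s` on the left and `1 + s` on the right, where `s` is the last simple transposition. -/
theorem exists_comm_t_penultimate_eq (R : Type*) [CommRing R] (m u : ℕ) (hu : u ≤ m + 2) :
    ∃ p, t R (m + 2) u * t R (m + 2) (m + 1) - t R (m + 2) (m + 1) * t R (m + 2) u =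
      (1 - MonoidAlgebra.of R _ (simpleTransposition (m + 2) (m + 1))) * p *
        (1 + MonoidAlgebra.of R _ (simpleTransposition (m + 2) (m + 1))) := by
  obtain rfl | hu' := hu.eq_or_lt
  · exact ⟨0, by simp [t_self]⟩
  have hs := congrArg (MonoidAlgebra.of R _) (simpleTransposition_mul_self (m + 2) (m + 1))
  have hc : Commute (∑ w ∈ Finset.Icc u m, MonoidAlgebra.of R _ (cyc (m + 2) u w))
      (MonoidAlgebra.of R _ (simpleTransposition (m + 2) (m + 1))) := by
    refine Commute.sum_left _ _ _ fun w hw => Commute.map (cyc_commute _ _ ?_) _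
    have := Finset.mem_Icc.mp hw
    omega
  refine ⟨MonoidAlgebra.of R _ (cyc (m + 2) u (m + 1)), ?_⟩
  rw [t_penultimate, t, Finset.sum_Icc_succ_top (by omega), Finset.sum_Icc_succ_top (by omega),
    cyc_succ (w := m + 1) _ (by omega)]
  rw [map_mul, map_one] at hs
  rw [map_mul]
  generalize MonoidAlgebra.of R _ (simpleTransposition (m + 2) (m + 1)) = s at *
  generalize MonoidAlgebra.of R _ (cyc (m + 2) u (m + 1)) = p at *
  generalize (∑ w ∈ Finset.Icc u m, MonoidAlgebra.of R _ (cyc (m + 2) u w)) = a at *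
  simp only [mul_add, add_mul, sub_mul, mul_one, one_mul, mul_assoc, hs, hc.eq]
  abel

theorem comm_t_nm1_square_vanishing
    (R : Type*) [CommRing R] (n : ℕ) (hn : 2 ≤ n)
    (u v : ℕ) (hu1 : 1 ≤ u) (hun : u ≤ n) (hv1 : 1 ≤ v) (hvn : v ≤ n) :
    (t R n u * t R n (n - 1) - t R n (n - 1) * t R n u) *
      (t R n v * t R n (n - 1) - t R n (n - 1) * t R n v) = 0 := by
  obtain ⟨m, rfl⟩ := Nat.exists_eq_add_of_le' hn
  obtain ⟨p, hp⟩ := exists_comm_t_penultimate_eq R m u hun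
  obtain ⟨q, hq⟩ := exists_comm_t_penultimate_eq R m v hvn
  have hs := congrArg (MonoidAlgebra.of R _) (simpleTransposition_mul_self (m + 2) (m + 1))
  rw [map_mul, map_one] at hs
  rw [show m + 2 - 1 = m + 1 from rfl, hp, hq]
  generalize MonoidAlgebra.of R _ (simpleTransposition (m + 2) (m + 1)) = s at *
  have h0 : (1 + s) * (1 - s) = 0 := by
    simp [mul_sub, add_mul, hs, add_comm]
  calc (1 - s) * p * (1 + s) * ((1 - s) * q * (1 + s))
      = (1 - s) * p * ((1 + s) * (1 - s)) * q * (1 + s) := by simp only [mul_assoc]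
    _ = 0 := by simp [h0]
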